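/- Let N be a finite set of bidders with item values v : N × {1,…,m} → ℝ such that for each item j the map i ↦ v_{ij} is injective. For subsets S ⊆ T ⊆ N with |S| ≥ m, and for every j ∈ {1,…,m}: r_j(S) ≤ r_j(T). -/

import Mathlib

open Finset
open scoped Classical BigOperators

/-- The iterative argmax-removal process: items are labeled `1, …, m`;
`sgt v S 0 = S`, and `sgt v S j` removes from `sgt v S (j-1)` the bidder(s) with
the highest value for item `j` (keeping exactly those bidders that are strictly
beaten by someone remaining). -/
noncomputable def sgt {ι : Type*} [DecidableEq ι] (v : ι → ℕ → ℝ) (S : Finset ι) :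
    ℕ → Finset ι
  | 0 => S
  | j + 1 => (sgt v S j).filter fun i => ∃ i' ∈ sgt v S j, v i (j + 1) < v i' (j + 1)

/-- `r_j(S) = v_{j*(S), j}`: the highest value for item `j` among `S_{>j-1}`. -/
noncomputable def rVal {ι : Type*} [DecidableEq ι] (v : ι → ℕ → ℝ) (S : Finset ι)
    (j : ℕ) : ℝ :=
  sSup {x : ℝ | ∃ i ∈ sgt v S (j - 1), v i j = x}

/-- The surviving bidders grow with the initial set. -/
theorem sgt_subset_sgt {ι : Type*} [DecidableEq ι] (v : ι → ℕ → ℝ) {S T : Finset ι}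
    (hST : S ⊆ T) (k : ℕ) : sgt v S k ⊆ sgt v T k := by
  induction k with
  | zero => exact hST
  | succ k ih =>
    intro i hi
    obtain ⟨hiS, i', hi', hlt⟩ := Finset.mem_filter.mp hi
    exact Finset.mem_filter.mpr ⟨ih hiS, i', ih hi', hlt⟩

/-- If the values for item `k + 1` are distinct, at most one bidder is removed for it. -/
theorem card_sgt_le_card_sgt_succ_add_one {ι : Type*} [DecidableEq ι] {v : ι → ℕ → ℝ} {k : ℕ}
    (hinj : Function.Injective fun i => v i (k + 1)) (S : Finset ι) :
    (sgt v S k).card ≤ (sgt v S (k + 1)).card + 1 := by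
  rcases (sgt v S k).eq_empty_or_nonempty with h | h
  · simp [h]
  obtain ⟨a, ha, hmax⟩ := (sgt v S k).exists_max_image (fun i => v i (k + 1)) h
  have hsub : (sgt v S k).erase a ⊆ sgt v S (k + 1) := by
    intro i hi
    obtain ⟨hne, hiS⟩ := Finset.mem_erase.mp hi
    exact Finset.mem_filter.mpr
      ⟨hiS, a, ha, lt_of_le_of_ne (hmax i hiS) fun h => hne (hinj h)⟩
  have := Finset.card_le_card hsub
  have := Finset.pred_card_le_card_erase (s := sgt v S k) (a := a)
  omega

/-- After `k` items with distinct values, at most `k` bidders have been removed. -/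
theorem card_le_card_sgt_add {ι : Type*} [DecidableEq ι] {v : ι → ℕ → ℝ} (S : Finset ι) {k : ℕ}
    (hinj : ∀ j ∈ Finset.Icc 1 k, Function.Injective fun i => v i j) :
    S.card ≤ (sgt v S k).card + k := by
  induction k with
  | zero => exact le_rfl
  | succ k ih =>
    have h₁ := ih fun j hj => hinj j (Finset.Icc_subset_Icc_right k.le_succ hj)
    have h₂ := card_sgt_le_card_sgt_succ_add_one (hinj (k + 1) (by simp)) S
    omega

/-- Corollary E.4 (cor:payment_mon): for subsets `S ⊆ T` of the bidders with
`|S| ≥ m`, and per-item-injective values, `r_j(S) ≤ r_j(T)` for every item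
`j ∈ {1, …, m}`. -/
theorem stmt15 {ι : Type*} [Fintype ι] [DecidableEq ι] {m : ℕ}
    (v : ι → ℕ → ℝ)
    (hinj : ∀ j ∈ Finset.Icc 1 m, Function.Injective fun i => v i j)
    (S T : Finset ι) (hST : S ⊆ T) (hScard : m ≤ S.card)
    (j : ℕ) (hj : j ∈ Finset.Icc 1 m) :
    rVal v S j ≤ rVal v T j := by
  obtain ⟨hj₁, hjm⟩ := Finset.mem_Icc.mp hj
  have hcard := card_le_card_sgt_add (v := v) S (k := j - 1)
    fun l hl => hinj l (Finset.Icc_subset_Icc_right (by omega) hl)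
  obtain ⟨a, ha⟩ : (sgt v S (j - 1)).Nonempty := Finset.card_pos.mp (by omega)
  refine csSup_le_csSup ?_ ⟨v a j, a, ha, rfl⟩ ?_
  · exact ((sgt v T (j - 1)).finite_toSet.image fun i => v i j).bddAbove
  · rintro x ⟨i, hi, rfl⟩
    exact ⟨i, sgt_subset_sgt v hST _ hi, rfl⟩
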